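/- An arbitrary series f ∈ K⟨υ^{−1/p^∞}⟩ is a unit of K⟨υ^{−1/p^∞}⟩ if and only if its constant coefficient strictly dominates all other coefficients, i.e., if and only if |f(q)| < |f(0)| for all q ∈ −D with q ≠ 0. -/

import Mathlib

open Filter

variable {K : Type*} [NontriviallyNormedField K] [IsUltrametricDist K] [CompleteSpace K]

/-- The exponent set `D = ℤ[1/p]_{≥0} = {a/p^b : a, b ∈ ℕ}`. -/
def Dset (p : ℕ) : Set ℚ := {q | ∃ a b : ℕ, q = (a : ℚ) / (p : ℚ) ^ b}

/-- The exponent set `−D = {−a/p^b : a, b ∈ ℕ}`. -/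
def negDset (p : ℕ) : Set ℚ := {q | ∃ a b : ℕ, q = -((a : ℚ) / (p : ℚ) ^ b)}

/-- The exponent set `ℤ[1/p] = {a/p^b : a ∈ ℤ, b ∈ ℕ}`. -/
def Zpset (p : ℕ) : Set ℚ := {q | ∃ (a : ℤ) (b : ℕ), q = (a : ℚ) / (p : ℚ) ^ b}

/-- Membership in the algebra of series supported on `S` with coefficients tending to `0`. -/
def MemAlg (S : Set ℚ) (f : ℚ → K) : Prop :=
  (∀ q, q ∉ S → f q = 0) ∧ Filter.Tendsto f Filter.cofinite (nhds 0)

/-- The Gauss norm `‖f‖ = sup_q |f q|`. -/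
noncomputable def gaussNorm (f : ℚ → K) : ℝ := ⨆ q : ℚ, ‖f q‖

/-- Convolution product of series. -/
noncomputable def conv (f g : ℚ → K) : ℚ → K := fun q => ∑' r : ℚ, f r * g (q - r)

/-- The multiplicative unit: the series `1`. -/
def oneF : ℚ → K := fun q => if q = 0 then 1 else 0

/-- `υ^d`: the series supported at the single exponent `d` with coefficient `1`. -/
def upsilon (d : ℚ) : ℚ → K := fun q => if q = d then 1 else 0

/-- `f` is a unit of the algebra of series supported on `S`. -/
def IsUnitIn (S : Set ℚ) (f : ℚ → K) : Prop :=
  MemAlg S f ∧ ∃ g : ℚ → K, MemAlg S g ∧ conv f g = oneF ∧ conv g f = oneF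

theorem aux_finite {t : ℚ → K} (ht : Tendsto t cofinite (nhds 0)) {ε : ℝ} (hε : 0 < ε) :
    {q | ε ≤ ‖t q‖}.Finite := by
  have h := (ht.norm).eventually_lt_const (u := ε) (by simpa using hε)
  rw [Filter.eventually_cofinite] at h
  simpa using h

theorem aux_max (t : ℚ → K) (ht : Tendsto t cofinite (nhds 0)) :
    ∃ a, ∀ r, ‖t r‖ ≤ ‖t a‖ := by
  by_cases h : ∀ r, t r = 0
  · exact ⟨0, fun r => by simp [h]⟩
  · push Not at h
    obtain ⟨s, hs⟩ := h
    have hfin := aux_finite ht (norm_pos_iff.2 hs)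
    obtain ⟨a, ha, hmax⟩ := Set.exists_max_image _ (fun q => ‖t q‖) hfin ⟨s, le_refl ‖t s‖⟩
    refine ⟨a, fun r => ?_⟩
    by_cases hr : ‖t s‖ ≤ ‖t r‖
    · exact hmax r hr
    · exact (not_le.1 hr).le.trans ha

theorem aux_lead (t : ℚ → K) (ht : Tendsto t cofinite (nhds 0)) (h0 : ∃ s, t s ≠ 0) :
    ∃ a, t a ≠ 0 ∧ (∀ r, ‖t r‖ ≤ ‖t a‖) ∧ ∀ r, r < a → ‖t r‖ < ‖t a‖ := by
  obtain ⟨m, hm⟩ := aux_max t ht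
  obtain ⟨s, hs⟩ := h0
  have hpos : 0 < ‖t m‖ := (norm_pos_iff.2 hs).trans_le (hm s)
  have hfin := aux_finite ht hpos
  obtain ⟨a, ha, hmin⟩ := Set.exists_min_image _ (fun q => q) hfin ⟨m, le_refl ‖t m‖⟩
  have ha' : ‖t m‖ ≤ ‖t a‖ := ha
  refine ⟨a, norm_pos_iff.1 (hpos.trans_le ha'), fun r => (hm r).trans ha', fun r hr => ?_⟩
  by_contra hc
  exact absurd (hmin r (ha'.trans (not_lt.1 hc))) (not_le.2 hr)

theorem aux_terms {f g : ℚ → K} (hf : Tendsto f cofinite (nhds 0)) {C : ℝ}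
    (hg : ∀ r, ‖g r‖ ≤ C) (q : ℚ) :
    Tendsto (fun r => f r * g (q - r)) cofinite (nhds 0) := by
  have h1 : Tendsto (fun r => ‖f r‖ * C) cofinite (nhds 0) := by
    simpa using (hf.norm).mul_const C
  refine squeeze_zero_norm (fun r => ?_) h1
  rw [norm_mul]
  exact mul_le_mul_of_nonneg_left (hg _) (norm_nonneg _)

theorem aux_summable {t : ℚ → K} (ht : Tendsto t cofinite (nhds 0)) : Summable t :=
  NonarchimedeanAddGroup.summable_of_tendsto_cofinite_zero ht

theorem aux_conv_norm {f g : ℚ → K} {A C : ℝ} (hA : 0 ≤ A) (hf : ∀ r, ‖f r‖ ≤ A)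
    (hg : ∀ r, ‖g r‖ ≤ C) (q : ℚ) : ‖conv f g q‖ ≤ A * C := by
  refine IsUltrametricDist.norm_tsum_le_of_forall_le fun r => ?_
  rw [norm_mul]
  exact mul_le_mul (hf _) (hg _) (norm_nonneg _) hA

theorem aux_conv_comm (f g : ℚ → K) : conv f g = conv g f := by
  funext q
  unfold conv
  rw [← (Equiv.subLeft q).tsum_eq]
  refine tsum_congr fun r => ?_
  simp [mul_comm]

theorem aux_negD_add {p : ℕ} (hp : p.Prime) {x y : ℚ} (hx : x ∈ negDset p)
    (hy : y ∈ negDset p) : x + y ∈ negDset p := by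
  obtain ⟨a, b, rfl⟩ := hx
  obtain ⟨c, d, rfl⟩ := hy
  have : (p : ℚ) ≠ 0 := by exact_mod_cast hp.ne_zero
  refine ⟨a * p ^ d + c * p ^ b, b + d, ?_⟩
  push_cast
  field_simp
  ring

theorem aux_negD_nonpos {p : ℕ} {x : ℚ} (hx : x ∈ negDset p) : x ≤ 0 := by
  obtain ⟨a, b, rfl⟩ := hx
  have : (0 : ℚ) ≤ (a : ℚ) / (p : ℚ) ^ b := by positivity
  linarith

theorem aux_conv_mem {p : ℕ} (hp : p.Prime) {f g : ℚ → K} (hf : MemAlg (negDset p) f)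
    (hg : MemAlg (negDset p) g) : MemAlg (negDset p) (conv f g) := by
  constructor
  · intro q hq
    unfold conv
    rw [← tsum_zero (β := ℚ) (α := K)]
    refine tsum_congr fun r => ?_
    by_cases h1 : r ∈ negDset p
    · have h2 : q - r ∉ negDset p := fun h2 => hq (by simpa using aux_negD_add hp h1 h2)
      simp [hg.1 _ h2]
    · simp [hf.1 _ h1]
  · obtain ⟨a, ha⟩ := aux_max f hf.2
    obtain ⟨b, hb⟩ := aux_max g hg.2
    set M : ℝ := ‖f a‖ + ‖g b‖ + 1 with hM
    have hMpos : 0 < M := by positivity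
    have hfM : ∀ r, ‖f r‖ ≤ M := fun r => (ha r).trans (by linarith [norm_nonneg (g b)])
    have hgM : ∀ r, ‖g r‖ ≤ M := fun r => (hb r).trans (by linarith [norm_nonneg (f a)])
    rw [tendsto_zero_iff_norm_tendsto_zero, Metric.tendsto_nhds]
    intro ε hε
    have hδ : 0 < ε / 2 / M := by positivity
    have hF := aux_finite hf.2 hδ
    have hG := aux_finite hg.2 hδ
    rw [Filter.eventually_cofinite]
    refine (hF.image2 (fun x y => x + y) hG).subset ?_
    intro q hq
    by_contra hc
    apply hq
    have key : ‖conv f g q‖ ≤ ε / 2 := by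
      refine IsUltrametricDist.norm_tsum_le_of_forall_le fun r => ?_
      rw [norm_mul]
      have e : ε / 2 = ε / 2 / M * M := by field_simp
      by_cases h1 : ε / 2 / M ≤ ‖f r‖
      · have h2 : ¬ ε / 2 / M ≤ ‖g (q - r)‖ := fun h2 => hc ⟨r, h1, q - r, h2, by simp⟩
        rw [e, mul_comm]
        exact mul_le_mul (not_le.1 h2).le (hfM _) (norm_nonneg _) hδ.le
      · rw [e]
        exact mul_le_mul (not_le.1 h1).le (hgM _) (norm_nonneg _) hδ.le
    simp only [Real.dist_eq, sub_zero, abs_norm]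
    linarith

theorem aux_forward {p : ℕ} {f g : ℚ → K} (hf : MemAlg (negDset p) f)
    (hg : MemAlg (negDset p) g) (h : conv f g = oneF) :
    ∀ q : ℚ, q ≠ 0 → ‖f q‖ < ‖f 0‖ := by
  have h1 : conv f g 0 ≠ 0 := by simp [h, oneF]
  have hf0 : ∃ s, f s ≠ 0 := by
    by_contra! hc
    exact h1 (by simp [conv, hc])
  have hg0 : ∃ s, g s ≠ 0 := by
    by_contra! hc
    exact h1 (by simp [conv, hc])
  obtain ⟨a, ha0, ha, hal⟩ := aux_lead f hf.2 hf0
  obtain ⟨b, hb0, hb, hbl⟩ := aux_lead g hg.2 hg0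
  have hne : conv f g (a + b) ≠ 0 := by
    intro hz
    have ht := aux_terms hf.2 hb (a + b)
    have hs := aux_summable ht
    unfold conv at hz
    rw [hs.tsum_eq_add_tsum_ite a] at hz
    set u : ℚ → K := fun r => if r = a then 0 else f r * g (a + b - r) with hu
    have hut : Tendsto u cofinite (nhds 0) := by
      refine squeeze_zero_norm (fun r => ?_) (tendsto_zero_iff_norm_tendsto_zero.1 ht)
      simp only [hu]
      split_ifs
      · rw [norm_zero]; exact norm_nonneg _
      · exact le_refl _
    have hlt : ∀ r, ‖u r‖ < ‖f a * g b‖ := by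
      intro r
      have hfa := norm_pos_iff.2 ha0
      have hgb := norm_pos_iff.2 hb0
      simp only [hu]
      split_ifs with hr
      · rw [norm_zero, norm_mul]; exact mul_pos hfa hgb
      · rw [norm_mul, norm_mul]
        rcases lt_or_gt_of_ne hr with hr | hr
        · exact mul_lt_mul_of_lt_of_le_of_nonneg_of_pos (hal r hr) (hb _) (norm_nonneg _) hgb
        · exact mul_lt_mul' (ha r) (hbl _ (by linarith)) (norm_nonneg _) hfa
    obtain ⟨m, hm⟩ := aux_max u hut
    have h2 : ‖∑' r, u r‖ ≤ ‖u m‖ := IsUltrametricDist.norm_tsum_le_of_forall_le hm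
    have h3 : f a * g b = - ∑' r, u r := by
      rw [add_sub_cancel_left] at hz
      exact eq_neg_of_add_eq_zero_left hz
    have h4 := hlt m
    rw [h3, norm_neg] at h4
    linarith
  have hab : a + b = 0 := by
    by_contra hc
    exact hne (by simp [h, oneF, hc])
  have ha' : a ≤ 0 := aux_negD_nonpos (p := p) (by by_contra hc; exact ha0 (hf.1 _ hc))
  have hb' : b ≤ 0 := aux_negD_nonpos (p := p) (by by_contra hc; exact hb0 (hg.1 _ hc))
  have haz : a = 0 := by linarith
  subst haz
  intro q hq
  rcases lt_or_gt_of_ne hq with hq | hq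
  · exact hal q hq
  · have : f q = 0 := hf.1 _ fun hc => absurd (aux_negD_nonpos hc) (not_le.2 hq)
    simpa [this] using ha0

theorem aux_zero_mem (p : ℕ) : (0 : ℚ) ∈ negDset p := ⟨0, 0, by simp⟩

theorem aux_const_mem (p : ℕ) (c : K) : MemAlg (negDset p) (fun q => c * oneF q) := by
  constructor
  · intro q hq
    have : q ≠ 0 := fun h => hq (h ▸ aux_zero_mem p)
    simp [oneF, this]
  · refine tendsto_nhds_of_eventually_eq ?_
    rw [Filter.eventually_cofinite]
    refine (Set.finite_singleton (0 : ℚ)).subset fun q hq => ?_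
    by_contra hc
    exact hq (by simp [oneF, show q ≠ 0 from hc])

theorem aux_add_mem {S : Set ℚ} {f g : ℚ → K} (hf : MemAlg S f) (hg : MemAlg S g) :
    MemAlg S (fun q => f q + g q) :=
  ⟨fun q hq => by simp [hf.1 q hq, hg.1 q hq], by simpa using hf.2.add hg.2⟩

theorem aux_closed (S : Set ℚ) :
    IsClosed {g : lp (fun _ : ℚ => K) ⊤ | MemAlg S (fun q => g q)} := by
  rw [← closure_subset_iff_isClosed]
  intro g hg
  rw [Metric.mem_closure_iff] at hg
  have hd : ∀ (x y : lp (fun _ : ℚ => K) ⊤) q, ‖x q - y q‖ ≤ dist x y := fun x y q => by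
    rw [dist_eq_norm]
    exact lp.norm_apply_le_norm ENNReal.top_ne_zero (x - y) q
  constructor
  · intro q hq
    by_contra hc
    obtain ⟨y, hy, hlt⟩ := hg _ (norm_pos_iff.2 hc)
    have h1 := hd g y q
    have h2 : y q = 0 := hy.1 q hq
    rw [h2, sub_zero] at h1
    exact absurd h1 (not_le.2 hlt)
  · rw [tendsto_zero_iff_norm_tendsto_zero, Metric.tendsto_nhds]
    intro ε hε
    obtain ⟨y, hy, hlt⟩ := hg (ε / 2) (by positivity)
    rw [Filter.eventually_cofinite]
    refine (aux_finite hy.2 (half_pos hε)).subset fun q hq => ?_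
    by_contra hc
    apply hq
    simp only [Real.dist_eq, sub_zero, abs_norm]
    have h1 := hd g y q
    have h2 : ‖y q‖ < ε / 2 := not_le.1 hc
    have h3 := norm_sub_norm_le (g q) (y q)
    linarith

theorem aux_solve {p : ℕ} (hp : p.Prime) (h : ℚ → K) (hh : MemAlg (negDset p) h) (c : K)
    (hlt : ∀ q, ‖h q‖ < 1) :
    ∃ g : ℚ → K, MemAlg (negDset p) g ∧ ∀ q, g q = c * oneF q + conv h g q := by
  obtain ⟨a, ha⟩ := aux_max h hh.2
  have hb : ∀ g : lp (fun _ : ℚ => K) ⊤, ∀ q, ‖g q‖ ≤ ‖g‖ := fun g q =>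
    lp.norm_apply_le_norm ENNReal.top_ne_zero g q
  have hmem : ∀ g : lp (fun _ : ℚ => K) ⊤,
      Memℓp (fun q => c * oneF q + conv h (fun q => g q) q) ⊤ := by
    intro g
    refine memℓp_infty ⟨‖c‖ + ‖h a‖ * ‖g‖, ?_⟩
    rintro _ ⟨q, rfl⟩
    refine (norm_add_le _ _).trans (add_le_add ?_ (aux_conv_norm (norm_nonneg _) ha (hb g) q))
    by_cases hq : q = 0 <;> simp [oneF, hq]
  let T : lp (fun _ : ℚ => K) ⊤ → lp (fun _ : ℚ => K) ⊤ := fun g => ⟨_, hmem g⟩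
  have hT : ∀ g q, T g q = c * oneF q + conv h (fun q => g q) q := fun g q => rfl
  have hcontr : ContractingWith ‖h a‖₊ T := by
    refine ⟨by exact_mod_cast hlt a, LipschitzWith.of_dist_le_mul fun x y => ?_⟩
    rw [dist_eq_norm, dist_eq_norm]
    refine lp.norm_le_of_forall_le (by positivity) fun q => ?_
    have e : (T x - T y) q = conv h (fun q => (x - y) q) q := by
      have e1 : (T x - T y) q = T x q - T y q := rfl
      rw [e1, hT, hT, add_sub_add_left_eq_sub]
      unfold conv
      rw [← (aux_summable (aux_terms hh.2 (hb x) q)).tsum_sub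
        (aux_summable (aux_terms hh.2 (hb y) q))]
      refine tsum_congr fun r => ?_
      rw [← mul_sub]
      rfl
    rw [e]
    exact aux_conv_norm (norm_nonneg _) ha (hb (x - y)) q
  have hmaps : Set.MapsTo T {g | MemAlg (negDset p) (fun q => g q)}
      {g | MemAlg (negDset p) (fun q => g q)} := fun g hg =>
    aux_add_mem (aux_const_mem p c) (aux_conv_mem hp hh hg)
  obtain ⟨g, hg, hfix, -⟩ := ContractingWith.exists_fixedPoint' (aux_closed (negDset p)).isComplete
    hmaps (hcontr.restrict hmaps) (x := 0) ⟨fun q _ => rfl, tendsto_const_nhds⟩ (edist_ne_top _ _)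
  refine ⟨fun q => g q, hg, fun q => ?_⟩
  rw [← hT, hfix]

theorem aux_backward {p : ℕ} (hp : p.Prime) {f : ℚ → K} (hf : MemAlg (negDset p) f)
    (hd : ∀ q : ℚ, q ≠ 0 → ‖f q‖ < ‖f 0‖) :
    ∃ g : ℚ → K, MemAlg (negDset p) g ∧ conv f g = oneF := by
  have h0 : 0 < ‖f 0‖ := (norm_nonneg _).trans_lt (hd 1 one_ne_zero)
  have h0' : f 0 ≠ 0 := norm_pos_iff.1 h0
  let h : ℚ → K := fun q => 1 * oneF q + -((f 0)⁻¹ * f q)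
  have hh : MemAlg (negDset p) h := by
    refine aux_add_mem (aux_const_mem p 1) ⟨fun q hq => by simp [hf.1 q hq], ?_⟩
    simpa using (hf.2.const_mul (f 0)⁻¹).neg
  have hlt : ∀ q, ‖h q‖ < 1 := by
    intro q
    by_cases hq : q = 0
    · subst hq; simp [h, oneF, h0']
    · have := hd q hq
      simp only [h, oneF, hq, if_false, mul_zero, zero_add, norm_neg, norm_mul, norm_inv]
      rw [inv_mul_lt_iff₀ h0]
      simpa using this
  obtain ⟨g, hg, hgq⟩ := aux_solve hp h hh (f 0)⁻¹ hlt
  refine ⟨g, hg, ?_⟩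
  obtain ⟨b, hb⟩ := aux_max g hg.2
  funext q
  have e1 : conv f g q = ∑' r, (f 0 * ((if r = 0 then g q else 0) - h r * g (q - r))) := by
    unfold conv
    refine tsum_congr fun r => ?_
    by_cases hr : r = 0
    · subst hr; simp [h, oneF, h0']
    · simp [h, oneF, hr, mul_assoc, mul_inv_cancel_left₀ h0']
  rw [e1, tsum_mul_left, Summable.tsum_sub (hasSum_ite_eq (0 : ℚ) (g q)).summable
    (aux_summable (aux_terms hh.2 hb q)), tsum_ite_eq]
  have e2 := hgq q
  have e3 : ∑' r, h r * g (q - r) = conv h g q := rfl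
  rw [e3, sub_eq_of_eq_add e2, mul_inv_cancel_left₀ h0']

/-- an arbitrary series `f ∈ K⟨υ^{−1/p^∞}⟩` is a unit iff its constant
coefficient strictly dominates all other coefficients: `|f q| < |f 0|` for all `q ≠ 0`. -/
theorem isUnit_iff_constant_dominates_neg (p : ℕ) (hp : p.Prime)
    (f : ℚ → K) (hf : MemAlg (negDset p) f) :
    IsUnitIn (negDset p) f ↔ (∀ q : ℚ, q ≠ 0 → ‖f q‖ < ‖f 0‖) := by
  constructor
  · rintro ⟨-, g, hg, h, -⟩
    exact aux_forward hf hg h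
  · intro hd
    obtain ⟨g, hg, h⟩ := aux_backward hp hf hd
    exact ⟨hf, g, hg, h, by rw [aux_conv_comm]; exact h⟩
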